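/- Let σ > 0, let X be a reflexive real Banach space (i.e., the canonical embedding of X into its bidual is surjective), and let f : X → ℝ be lower semicontinuous and σ-strongly quasiconvex. Then for every v ∈ X the proximal set prox_f(v) = argmin_{x ∈ X} ( f(x) + (1/2)‖x − v‖² ) is nonempty. -/

import Mathlib

/-- A real-valued function `f` is `σ`-quasiconvex on a set `Ω` if
`f (λx + (1-λ)y) ≤ max (f x) (f y) - (σ/2)·λ(1-λ)·‖x-y‖²` for all `x, y ∈ Ω` and
`0 < λ < 1`. -/
def SQuasiconvexOnR {X : Type*} [NormedAddCommGroup X] [NormedSpace ℝ X]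
    (σ : ℝ) (Ω : Set X) (f : X → ℝ) : Prop :=
  ∀ x ∈ Ω, ∀ y ∈ Ω, ∀ l : ℝ, 0 < l → l < 1 →
    f (l • x + (1 - l) • y) ≤
      max (f x) (f y) - σ / 2 * (l * (1 - l)) * ‖x - y‖ ^ 2

/-- In a reflexive space, bounded sets are relatively weakly compact. -/
theorem isCompact_closure_toWeakSpace_image_of_reflexive {X : Type*} [NormedAddCommGroup X]
    [NormedSpace ℝ X]
    (hrefl : Function.Surjective ⇑(NormedSpace.inclusionInDoubleDual ℝ X))
    {s : Set X} (hs : Bornology.IsBounded s) :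
    IsCompact (closure (toWeakSpace ℝ X '' s)) := by
  refine NormedSpace.isCompact_closure_of_isBounded ℝ X _ ?_ ?_
  · rwa [Set.preimage_image_eq _ (toWeakSpace ℝ X).injective]
  · intro φ _
    obtain ⟨x, hx⟩ := hrefl (WeakDual.toStrongDual φ)
    refine ⟨toWeakSpace ℝ X x, ?_⟩
    exact congrArg StrongDual.toWeakDual hx

/-- A lower semicontinuous quasiconvex function is weakly lower semicontinuous. -/
theorem QuasiconvexOn.lowerSemicontinuous_weakSpace {X : Type*} [NormedAddCommGroup X]
    [NormedSpace ℝ X] {f : X → ℝ} (hf : QuasiconvexOn ℝ Set.univ f)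
    (hlsc : LowerSemicontinuous f) :
    LowerSemicontinuous fun x : WeakSpace ℝ X ↦ f ((toWeakSpace ℝ X).symm x) := by
  rw [lowerSemicontinuous_iff_isClosed_preimage]
  intro r
  have hconv : Convex ℝ (f ⁻¹' Set.Iic r) := by simpa [Set.preimage] using hf r
  have himage : (fun x : WeakSpace ℝ X ↦ f ((toWeakSpace ℝ X).symm x)) ⁻¹' Set.Iic r =
      toWeakSpace ℝ X '' (f ⁻¹' Set.Iic r) := by
    rw [LinearEquiv.image_eq_preimage_symm]
    rfl
  rw [himage, ← (hlsc.isClosed_preimage r).closure_eq, hconv.toWeakSpace_closure ℝ]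
  exact isClosed_closure

/-- In a reflexive space, for a weakly lower semicontinuous function and a nonempty bounded set `s`,
some point of the space (in the weak closure of `s`) has value at most every value on `s`. -/
theorem exists_forall_mem_le_of_isBounded_of_reflexive {X : Type*} [NormedAddCommGroup X]
    [NormedSpace ℝ X]
    (hrefl : Function.Surjective ⇑(NormedSpace.inclusionInDoubleDual ℝ X)) {f : X → ℝ}
    (hf : LowerSemicontinuous fun x : WeakSpace ℝ X ↦ f ((toWeakSpace ℝ X).symm x))
    {s : Set X} (hs : Bornology.IsBounded s) (hne : s.Nonempty) :
    ∃ x, ∀ z ∈ s, f x ≤ f z := by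
  obtain ⟨x, -, hx⟩ := (hf.lowerSemicontinuousOn _).exists_isMinOn
    (hne.image (toWeakSpace ℝ X)).closure
    (isCompact_closure_toWeakSpace_image_of_reflexive hrefl hs)
  refine ⟨(toWeakSpace ℝ X).symm x, fun z hz ↦ ?_⟩
  simpa using hx (subset_closure (Set.mem_image_of_mem _ hz))

theorem SQuasiconvexOnR.quasiconvexOn {X : Type*} [NormedAddCommGroup X] [NormedSpace ℝ X]
    {σ : ℝ} (hσ : 0 ≤ σ) {Ω : Set X} (hΩ : Convex ℝ Ω) {f : X → ℝ}
    (hf : SQuasiconvexOnR σ Ω f) : QuasiconvexOn ℝ Ω f := by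
  intro r
  rw [convex_iff_forall_pos]
  rintro x ⟨hx, hxr⟩ y ⟨hy, hyr⟩ a b ha hb hab
  refine ⟨hΩ hx hy ha.le hb.le hab, ?_⟩
  obtain rfl : b = 1 - a := by linarith
  have h := hf x hx y hy a ha (by linarith)
  have hpos : 0 ≤ σ / 2 * (a * (1 - a)) * ‖x - y‖ ^ 2 := by positivity
  linarith [max_le hxr hyr]

/-- The sublevel sets of a strongly quasiconvex function that is bounded below on the unit ball
are bounded. -/
theorem SQuasiconvexOnR.isBounded_sublevel {X : Type*} [NormedAddCommGroup X] [NormedSpace ℝ X]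
    {σ : ℝ} (hσ : 0 < σ) {f : X → ℝ} (hf : SQuasiconvexOnR σ Set.univ f) {m : ℝ}
    (hm : ∀ z ∈ Metric.closedBall (0 : X) 1, m ≤ f z) (c : ℝ) :
    Bornology.IsBounded {x | f x ≤ c} := by
  rw [isBounded_iff_forall_norm_le]
  refine ⟨max 1 (1 + 2 / σ * (max c (f 0) - m)), fun x hx ↦ ?_⟩
  rw [le_max_iff, or_iff_not_imp_left, not_le]
  intro h1
  have h0 : 0 < ‖x‖ := by linarith
  have h := hf x trivial 0 trivial ‖x‖⁻¹ (by positivity) (inv_lt_one_of_one_lt₀ h1)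
  have hball := hm (‖x‖⁻¹ • x + (1 - ‖x‖⁻¹) • (0 : X)) (by simp [norm_smul, h0.ne'])
  have hmax : max (f x) (f 0) ≤ max c (f 0) := max_le_max_right _ hx
  have hquad : σ / 2 * (‖x‖⁻¹ * (1 - ‖x‖⁻¹)) * ‖x - 0‖ ^ 2 = σ / 2 * (‖x‖ - 1) := by
    rw [sub_zero]
    field_simp
  have hle : σ / 2 * (‖x‖ - 1) ≤ max c (f 0) - m := by linarith
  have hscale : 2 / σ * (σ / 2 * (‖x‖ - 1)) = ‖x‖ - 1 := by field_simp
  have := mul_le_mul_of_nonneg_left hle (by positivity : 0 ≤ 2 / σ)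
  linarith

theorem stmt_18 {X : Type*} [NormedAddCommGroup X] [NormedSpace ℝ X] [CompleteSpace X]
    (hrefl : Function.Surjective ⇑(NormedSpace.inclusionInDoubleDual ℝ X))
    {σ : ℝ} (hσ : 0 < σ) {f : X → ℝ} (hlsc : LowerSemicontinuous f)
    (hf : SQuasiconvexOnR σ Set.univ f) :
    ∀ v : X, ∃ x : X, ∀ z : X,
      f x + 1 / 2 * ‖x - v‖ ^ 2 ≤ f z + 1 / 2 * ‖z - v‖ ^ 2 := by
  intro v
  have hfw := (hf.quasiconvexOn hσ.le convex_univ).lowerSemicontinuous_weakSpace hlsc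
  obtain ⟨y, hy⟩ := exists_forall_mem_le_of_isBounded_of_reflexive hrefl hfw
    (Metric.isBounded_closedBall (x := (0 : X)) (r := 1)) ⟨0, by simp⟩
  have hconv : ConvexOn ℝ Set.univ fun x : X ↦ 1 / 2 * ‖x - v‖ ^ 2 := by
    have h := (convexOn_dist v convex_univ).pow (fun _ _ ↦ dist_nonneg) 2
    simpa [dist_eq_norm] using h.smul (by norm_num : (0 : ℝ) ≤ 1 / 2)
  have hcont : Continuous fun x : X ↦ 1 / 2 * ‖x - v‖ ^ 2 := by fun_prop
  have hgw := hfw.add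
    (hconv.quasiconvexOn.lowerSemicontinuous_weakSpace hcont.lowerSemicontinuous)
  obtain ⟨x, hx⟩ := exists_forall_mem_le_of_isBounded_of_reflexive
    (f := fun x ↦ f x + 1 / 2 * ‖x - v‖ ^ 2) hrefl hgw
    (hf.isBounded_sublevel hσ hy (f v)) ⟨v, le_refl (f v)⟩
  refine ⟨x, fun z ↦ ?_⟩
  by_cases hz : f z ≤ f v
  · exact hx z hz
  · have hxv : f x + 1 / 2 * ‖x - v‖ ^ 2 ≤ f v + 1 / 2 * ‖v - v‖ ^ 2 := hx v (le_refl (f v))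
    have hnn : 0 ≤ 1 / 2 * ‖z - v‖ ^ 2 := by positivity
    simp only [sub_self, norm_zero] at hxv
    linarith
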